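/- Let 0≤α<n and 1<p≤q<∞, and set β=n(1/p−1/q). Let Φ be a Young function whose associate function Φ̄ satisfies the B^β_p condition, and suppose the pair of weights (u,σ) satisfies [u,σ]_{A^α_{p,q,Φ}}<∞. Then ‖M_α(·σ)‖_{L^p(σ)→L^q(u)} ≤ C·[u,σ]_{A^α_{p,q,Φ}}·‖M_{β,Φ̄}‖_{L^p→L^q}, where C depends only on n, α, p and q. -/

import Mathlib

open MeasureTheory ENNReal Set

noncomputable section

/-- `ℝ^n` with Lebesgue measure. -/
abbrev Rn (n : ℕ) : Type := Fin n → ℝ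

/-- An axis-parallel (half-open) cube in `ℝ^n`. -/
structure Cube (n : ℕ) where
  corner : Fin n → ℝ
  side : ℝ
  side_pos : 0 < side

/-- The underlying set of a cube. -/
def Cube.set {n : ℕ} (Q : Cube n) : Set (Rn n) :=
  {x | ∀ i, Q.corner i ≤ x i ∧ x i < Q.corner i + Q.side}

/-- The volume `|Q|` of a cube. -/
def Cube.vol {n : ℕ} (Q : Cube n) : ℝ := Q.side ^ n

/-- Conjugate exponent `p' = p/(p-1)`. -/
def conjExp (p : ℝ) : ℝ := p / (p - 1)

/-- Average over a cube of an `ℝ≥0∞`-valued function. -/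
def avgE {n : ℕ} (Q : Cube n) (g : Rn n → ℝ≥0∞) : ℝ≥0∞ :=
  (∫⁻ x in Q.set, g x) / ENNReal.ofReal Q.vol

/-- Average over a cube of a (nonnegative) real weight. -/
def avgW {n : ℕ} (Q : Cube n) (w : Rn n → ℝ) : ℝ≥0∞ :=
  avgE Q fun x => ENNReal.ofReal (w x)

/-- Weighted `L^p` norm `‖f‖_{L^p(w)}` of an `ℝ≥0∞`-valued function. -/
def LpW {n : ℕ} (f : Rn n → ℝ≥0∞) (p : ℝ) (w : Rn n → ℝ) : ℝ≥0∞ :=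
  (∫⁻ x, f x ^ p * ENNReal.ofReal (w x)) ^ (1 / p)

/-- Weighted weak `L^q` quasinorm `‖f‖_{L^{q,∞}(w)}`. -/
def WeakLpW {n : ℕ} (f : Rn n → ℝ≥0∞) (q : ℝ) (w : Rn n → ℝ) : ℝ≥0∞ :=
  ⨆ (t : ℝ) (_ : 0 < t),
    ENNReal.ofReal t *
      (∫⁻ x in {x | ENNReal.ofReal t < f x}, ENNReal.ofReal (w x)) ^ (1 / q)

/-- The fractional maximal operator `M_α`. -/
def fracMax {n : ℕ} (α : ℝ) (f : Rn n → ℝ≥0∞) (x : Rn n) : ℝ≥0∞ :=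
  ⨆ (Q : Cube n) (_ : x ∈ Q.set),
    ENNReal.ofReal (Q.vol ^ (α / n - 1)) * ∫⁻ y in Q.set, f y

/-- The Euclidean norm on `ℝ^n`. -/
def eucNorm {n : ℕ} (x : Rn n) : ℝ := Real.sqrt (∑ i, x i ^ 2)

/-- The Riesz potential `I_α`. -/
def riesz {n : ℕ} (α : ℝ) (f : Rn n → ℝ≥0∞) (x : Rn n) : ℝ≥0∞ :=
  ∫⁻ y, f y * ENNReal.ofReal (eucNorm (x - y) ^ (α - n))

/-- The product `fσ` of an `ℝ≥0∞`-valued function with a weight. -/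
def mulW {n : ℕ} (f : Rn n → ℝ≥0∞) (w : Rn n → ℝ) : Rn n → ℝ≥0∞ :=
  fun x => f x * ENNReal.ofReal (w x)

/-- The operator norm `‖T(·σ)‖_{L^p(σ) → L^q(u)}` (least admissible constant). -/
def opNormStrong {n : ℕ} (T : (Rn n → ℝ≥0∞) → Rn n → ℝ≥0∞) (p q : ℝ)
    (σ u : Rn n → ℝ) : ℝ≥0∞ :=
  ⨆ (f : Rn n → ℝ≥0∞) (_ : Measurable f), LpW (T (mulW f σ)) q u / LpW f p σ

/-- The weak-type operator norm `‖T(·σ)‖_{L^p(σ) → L^{q,∞}(u)}`. -/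
def opNormWeak {n : ℕ} (T : (Rn n → ℝ≥0∞) → Rn n → ℝ≥0∞) (p q : ℝ)
    (σ u : Rn n → ℝ) : ℝ≥0∞ :=
  ⨆ (f : Rn n → ℝ≥0∞) (_ : Measurable f), WeakLpW (T (mulW f σ)) q u / LpW f p σ

/-- The operator norm `‖T‖_{L^p(v) → L^q(u)}` (no multiplication by the weight). -/
def opNormPlain {n : ℕ} (T : (Rn n → ℝ≥0∞) → Rn n → ℝ≥0∞) (p q : ℝ)
    (v u : Rn n → ℝ) : ℝ≥0∞ :=
  ⨆ (f : Rn n → ℝ≥0∞) (_ : Measurable f), LpW (T f) q u / LpW f p v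

/-- The weak-type operator norm `‖T‖_{L^p(v) → L^{q,∞}(u)}`. -/
def opNormPlainWeak {n : ℕ} (T : (Rn n → ℝ≥0∞) → Rn n → ℝ≥0∞) (p q : ℝ)
    (v u : Rn n → ℝ) : ℝ≥0∞ :=
  ⨆ (f : Rn n → ℝ≥0∞) (_ : Measurable f), WeakLpW (T f) q u / LpW f p v

/-- A weight: a nonnegative locally integrable (measurable) function. -/
def IsWeight {n : ℕ} (w : Rn n → ℝ) : Prop :=
  Measurable w ∧ (∀ x, 0 ≤ w x) ∧ LocallyIntegrable w volume

/-- The local `A^α_{p,q}` functional `A^α_{p,q}(u,σ,Q)`. -/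
def ApqQ {n : ℕ} (α p q : ℝ) (u σ : Rn n → ℝ) (Q : Cube n) : ℝ≥0∞ :=
  ENNReal.ofReal (Q.vol ^ (α / n + 1 / q - 1 / p)) * avgW Q u ^ (1 / q) *
    avgW Q σ ^ (1 / conjExp p)

/-- The joint constant `[u,σ]_{A^α_{p,q}}`. -/
def Apq {n : ℕ} (α p q : ℝ) (u σ : Rn n → ℝ) : ℝ≥0∞ :=
  ⨆ Q : Cube n, ApqQ α p q u σ Q

/-- `A^α_{p,q}` for `ℝ≥0∞`-valued weights. -/
def ApqE {n : ℕ} (α p q : ℝ) (u σ : Rn n → ℝ≥0∞) : ℝ≥0∞ :=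
  ⨆ Q : Cube n,
    ENNReal.ofReal (Q.vol ^ (α / n + 1 / q - 1 / p)) * avgE Q u ^ (1 / q) *
      avgE Q σ ^ (1 / conjExp p)

/-- Real-valued average over a cube. -/
def avgR {n : ℕ} (Q : Cube n) (w : Rn n → ℝ) : ℝ := (∫ x in Q.set, w x) / Q.vol

/-- The local exponential `A_∞` functional `A^{exp}_∞(w,Q)`. -/
def AexpQ {n : ℕ} (Q : Cube n) (w : Rn n → ℝ) : ℝ :=
  avgR Q w * Real.exp (- avgR Q fun x => Real.log (w x))

/-- `w ∈ A_∞` (exponential definition). -/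
def IsAinf {n : ℕ} (w : Rn n → ℝ) : Prop :=
  ∃ C : ℝ, ∀ Q : Cube n,
    IntegrableOn (fun x => Real.log (w x)) Q.set volume ∧ AexpQ Q w ≤ C

/-- The local Fujii–Wilson functional `A^M_∞(w,Q) = w(Q)⁻¹ ∫_Q M(wχ_Q)`. -/
def FWQ {n : ℕ} (Q : Cube n) (w : Rn n → ℝ) : ℝ≥0∞ :=
  (∫⁻ x in Q.set, fracMax 0 (Q.set.indicator fun y => ENNReal.ofReal (w y)) x) /
    ∫⁻ x in Q.set, ENNReal.ofReal (w x)

/-- The Fujii–Wilson constant `[w]_{A^M_∞}`. -/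
def FW {n : ℕ} (w : Rn n → ℝ) : ℝ≥0∞ := ⨆ Q : Cube n, FWQ Q w

/-- The local Muckenhoupt `A_r` functional. -/
def ArQ {n : ℕ} (r : ℝ) (v : Rn n → ℝ) (Q : Cube n) : ℝ≥0∞ :=
  avgW Q v * (avgE Q fun x => ENNReal.ofReal (v x) ^ (1 - conjExp r)) ^ (r - 1)

/-- The Muckenhoupt constant `[v]_{A_r}`. -/
def ArC {n : ℕ} (r : ℝ) (v : Rn n → ℝ) : ℝ≥0∞ := ⨆ Q : Cube n, ArQ r v Q

/-- The mixed constant `[v]_{(A_r)^β (A^M_∞)^γ}`. -/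
def mixedC {n : ℕ} (r β γ : ℝ) (v : Rn n → ℝ) : ℝ≥0∞ :=
  ⨆ Q : Cube n, ArQ r v Q ^ β * FWQ Q v ^ γ

/-- `Φ(t) = 1 + log t` applied to an `ℝ≥0∞` constant. -/
def PhiLog (X : ℝ≥0∞) : ℝ≥0∞ :=
  if X = ∞ then ∞ else ENNReal.ofReal (1 + Real.log X.toReal)

/-- A Young function. -/
def IsYoung (Φ : ℝ → ℝ) : Prop :=
  ContinuousOn Φ (Ici 0) ∧ ConvexOn ℝ (Ici 0) Φ ∧ StrictMonoOn Φ (Ici 0) ∧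
    Φ 0 = 0 ∧ Filter.Tendsto (fun t => Φ t / t) Filter.atTop Filter.atTop

/-- The associate (conjugate) Young function `Φ̄(t) = sup_{s>0} (st - Φ(s))`. -/
def assocFn (Φ : ℝ → ℝ) (t : ℝ) : ℝ :=
  sSup {y : ℝ | ∃ s : ℝ, 0 < s ∧ y = s * t - Φ s}

/-- The localized Luxemburg average `‖f‖_{Φ,Q}`. -/
def luxNorm {n : ℕ} (Φ : ℝ → ℝ) (Q : Cube n) (f : Rn n → ℝ) : ℝ≥0∞ :=
  sInf ((fun l : ℝ => ENNReal.ofReal l) ''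
    {l : ℝ | 0 < l ∧
      (∫⁻ x in Q.set, ENNReal.ofReal (Φ (|f x| / l))) ≤ ENNReal.ofReal Q.vol})

/-- The fractional Orlicz maximal operator `M_{β,Φ}`. -/
def orliczMax {n : ℕ} (β : ℝ) (Φ : ℝ → ℝ) (f : Rn n → ℝ) (x : Rn n) : ℝ≥0∞ :=
  ⨆ (Q : Cube n) (_ : x ∈ Q.set), ENNReal.ofReal (Q.vol ^ (β / n)) * luxNorm Φ Q f

/-- Unweighted `L^p` norm of a real function. -/
def Lp0 {n : ℕ} (f : Rn n → ℝ) (p : ℝ) : ℝ≥0∞ :=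
  (∫⁻ x, ENNReal.ofReal |f x| ^ p) ^ (1 / p)

/-- Unweighted `L^p` norm of an `ℝ≥0∞`-valued function. -/
def LpE {n : ℕ} (g : Rn n → ℝ≥0∞) (p : ℝ) : ℝ≥0∞ :=
  (∫⁻ x, g x ^ p) ^ (1 / p)

/-- The unweighted operator norm `‖M_{β,Φ}‖_{L^p → L^q}`. -/
def orliczMaxNorm (n : ℕ) (β : ℝ) (Φ : ℝ → ℝ) (p q : ℝ) : ℝ≥0∞ :=
  ⨆ (f : Rn n → ℝ) (_ : Measurable f), LpE (orliczMax β Φ f) q / Lp0 f p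

/-- The `B^β_p` integral `∫_c^∞ Φ(t)^{q/p} t^{-q} dt/t`, where `1/q = 1/p - β/n`. -/
def BInt (Φ : ℝ → ℝ) (p q : ℝ) (c : ℝ) : ℝ≥0∞ :=
  ∫⁻ t in Ioi c, ENNReal.ofReal (Φ t ^ (q / p) * t ^ (-q) / t)

/-- The `B^β_p` condition (with `q` given by `1/q = 1/p - β/n`). -/
def BCond (Φ : ℝ → ℝ) (p q : ℝ) : Prop := ∃ c : ℝ, 0 < c ∧ BInt Φ p q c < ∞

/-- The bump constant `[u,σ]_{A^α_{p,q,Φ}}`. -/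
def bumpA {n : ℕ} (α p q : ℝ) (Φ : ℝ → ℝ) (u σ : Rn n → ℝ) : ℝ≥0∞ :=
  ⨆ Q : Cube n,
    ENNReal.ofReal (Q.vol ^ (α / n + 1 / q - 1 / p)) * avgW Q u ^ (1 / q) *
      luxNorm Φ Q (fun x => σ x ^ (1 / conjExp p))

/-- A dyadic grid in `ℝ^n`. -/
def IsDyadicGrid {n : ℕ} (D : Set (Cube n)) : Prop :=
  (∀ Q ∈ D, ∃ k : ℤ, Q.side = (2 : ℝ) ^ k) ∧
  (∀ Q ∈ D, ∀ P ∈ D, Q.set ∩ P.set = P.set ∨ Q.set ∩ P.set = Q.set ∨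
    Q.set ∩ P.set = ∅) ∧
  (∀ k : ℤ, ∀ x : Rn n, ∃! Q : Cube n, Q ∈ D ∧ Q.side = (2 : ℝ) ^ k ∧ x ∈ Q.set)

/-- The outer dyadic Riesz potential `I_α^{Q₀}`. -/
def outerRiesz {n : ℕ} (D : Set (Cube n)) (α : ℝ) (Q₀ : Cube n)
    (f : Rn n → ℝ≥0∞) (x : Rn n) : ℝ≥0∞ :=
  ∑' Q : {Q : Cube n // Q ∈ D ∧ Q₀.set ⊆ Q.set},
    Q.1.set.indicator
      (fun _ => ENNReal.ofReal (Q.1.vol ^ (α / n - 1)) * ∫⁻ y in Q.1.set, f y) x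

/-- The outer testing constant `[u,σ]_{I_α^{out},p,q}`. -/
def outerTest {n : ℕ} (D : Set (Cube n)) (α p q : ℝ) (u σ : Rn n → ℝ) : ℝ≥0∞ :=
  ⨆ (Q₀ : Cube n) (_ : Q₀ ∈ D),
    (∫⁻ x, outerRiesz D α Q₀ (Q₀.set.indicator fun y => ENNReal.ofReal (σ y)) x ^ q *
        ENNReal.ofReal (u x)) ^ (1 / q) /
      (∫⁻ x in Q₀.set, ENNReal.ofReal (σ x)) ^ (1 / p)

/-- The dyadic fractional maximal operator `M_α^𝒟`. -/
def dyadicFracMax {n : ℕ} (D : Set (Cube n)) (α : ℝ) (f : Rn n → ℝ≥0∞)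
    (x : Rn n) : ℝ≥0∞ :=
  ⨆ (Q : Cube n) (_ : Q ∈ D) (_ : x ∈ Q.set),
    ENNReal.ofReal (Q.vol ^ (α / n - 1)) * ∫⁻ y in Q.set, f y

/-- A sparse family `S ⊆ D` with associated disjoint thick subsets `E Q ⊆ Q`. -/
def IsSparse {n : ℕ} (D S : Set (Cube n)) (E : Cube n → Set (Rn n)) : Prop :=
  S ⊆ D ∧
  (∀ Q ∈ S, E Q ⊆ Q.set ∧ MeasurableSet (E Q) ∧
    ENNReal.ofReal Q.vol ≤ 2 * volume (E Q)) ∧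
  S.PairwiseDisjoint E

/-- The sparse operator `L_α^S`. -/
def sparseOp {n : ℕ} (S : Set (Cube n)) (E : Cube n → Set (Rn n)) (α : ℝ)
    (f : Rn n → ℝ≥0∞) (x : Rn n) : ℝ≥0∞ :=
  ∑' Q : S,
    (E Q.1).indicator
      (fun _ => ENNReal.ofReal (Q.1.vol ^ (α / n - 1)) * ∫⁻ y in Q.1.set, f y) x

/-- The one-dimensional fractional maximal operator over bounded intervals. -/
def fm1 (γ : ℝ) (f : ℝ → ℝ≥0∞) (x : ℝ) : ℝ≥0∞ :=
  ⨆ (a : ℝ) (b : ℝ) (_ : a < b) (_ : x ∈ Icc a b),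
    ENNReal.ofReal ((b - a) ^ (γ - 1)) * ∫⁻ y in Ioo a b, f y

lemma Cube.set_eq_pi {n : ℕ} (Q : Cube n) :
    Q.set = Set.pi univ fun i => Ico (Q.corner i) (Q.corner i + Q.side) := by
  ext x; simp [Cube.set]

lemma Cube.measurableSet_set {n : ℕ} (Q : Cube n) : MeasurableSet Q.set := by
  rw [Q.set_eq_pi]
  exact MeasurableSet.univ_pi fun i => measurableSet_Ico

lemma Cube.vol_pos {n : ℕ} (Q : Cube n) : 0 < Q.vol := pow_pos Q.side_pos n

lemma Cube.volume_set {n : ℕ} (Q : Cube n) : volume Q.set = ENNReal.ofReal Q.vol := by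
  rw [Q.set_eq_pi, Real.volume_pi_Ico]
  simp [Cube.vol, ENNReal.ofReal_pow Q.side_pos.le]

lemma Cube.vol_rpow {n : ℕ} (hn : 0 < n) (Q : Cube n) (a : ℝ) :
    Q.vol ^ (a / n) = Q.side ^ a := by
  have h : (n : ℝ) ≠ 0 := by positivity
  rw [Cube.vol, ← Real.rpow_natCast, ← Real.rpow_mul Q.side_pos.le]
  congr 1
  field_simp

lemma Cube.vol_rpow_sub_one {n : ℕ} (hn : 0 < n) (Q : Cube n) (α : ℝ) :
    Q.vol ^ (α / n - 1) = Q.side ^ (α - n) := by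
  have h : (n : ℝ) ≠ 0 := by positivity
  rw [← Q.vol_rpow hn (α - n), sub_div, div_self h]

/-- The fractional average `|Q|^{α/n - 1} ∫_Q g`. -/
def fracAvg {n : ℕ} (α : ℝ) (g : Rn n → ℝ≥0∞) (Q : Cube n) : ℝ≥0∞ :=
  ENNReal.ofReal (Q.vol ^ (α / n - 1)) * ∫⁻ y in Q.set, g y

/-- The standard dyadic cube of side `2 ^ k` with corner `2 ^ k m`. -/
def dyCube {n : ℕ} (k : ℤ) (m : Fin n → ℤ) : Cube n where
  corner i := m i * 2 ^ k
  side := 2 ^ k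
  side_pos := by positivity

/-- The index of the standard dyadic cube of side `2 ^ k` containing `x`. -/
def dyIdx {n : ℕ} (k : ℤ) (x : Rn n) : Fin n → ℤ := fun i => ⌊x i / 2 ^ k⌋

lemma mem_dyCube {n : ℕ} {k : ℤ} {m : Fin n → ℤ} {x : Rn n} :
    x ∈ (dyCube k m).set ↔ dyIdx k x = m := by
  have h : (0 : ℝ) < 2 ^ k := by positivity
  simp only [Cube.set, dyCube, mem_ofPred_eq, dyIdx, funext_iff, Int.floor_eq_iff]
  refine forall_congr' fun i => ?_
  rw [le_div_iff₀ h, div_lt_iff₀ h, add_mul, one_mul]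

lemma dyIdx_congr {n : ℕ} {k l : ℤ} (hkl : k ≤ l) {x y : Rn n}
    (h : dyIdx k x = dyIdx k y) : dyIdx l x = dyIdx l y := by
  obtain ⟨j, rfl⟩ := Int.le.dest hkl
  have key : ∀ z : Rn n, ∀ i, dyIdx (k + j) z i = dyIdx k z i / (2 ^ j : ℕ) := by
    intro z i
    simp only [dyIdx]
    rw [← Int.floor_div_natCast]
    congr 1
    rw [zpow_add₀ (by norm_num), zpow_natCast, div_div]
    push_cast
    rfl
  funext i
  rw [key, key, h]

lemma dyCube_subset {n : ℕ} {k l : ℤ} (hkl : k ≤ l) {m m' : Fin n → ℤ} {x : Rn n}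
    (hx : x ∈ (dyCube k m).set) (hx' : x ∈ (dyCube l m').set) :
    (dyCube k m).set ⊆ (dyCube l m').set := by
  intro y hy
  rw [mem_dyCube] at *
  rw [← hx']
  exact dyIdx_congr hkl (hy.trans hx.symm)

/-- The concentric cube with three times the side. -/
def Cube.triple {n : ℕ} (Q : Cube n) : Cube n where
  corner i := Q.corner i - Q.side
  side := 3 * Q.side
  side_pos := by have := Q.side_pos; positivity

lemma Cube.subset_triple {n : ℕ} (Q : Cube n) : Q.set ⊆ Q.triple.set := by
  intro x hx i
  have := hx i
  have := Q.side_pos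
  simp only [Cube.triple]
  constructor <;> linarith

lemma Cube.triple_mono {n : ℕ} (hn : 0 < n) {P Q : Cube n} (h : P.set ⊆ Q.set) :
    P.triple.set ⊆ Q.triple.set := by
  have hP := P.side_pos
  have hc : P.corner ∈ Q.set := h fun i => ⟨le_rfl, by linarith⟩
  have he : ∀ i, P.corner i + P.side ≤ Q.corner i + Q.side := by
    intro i
    refine le_of_forall_lt fun c hcc => ?_
    by_contra! hlt
    have hm : (fun j => max (P.corner j) (c - P.corner i + P.corner j)) ∈ P.set := by
      intro j
      refine ⟨le_max_left _ _, max_lt (by linarith) (by linarith)⟩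
    have := (h hm i).2
    have h2 := le_max_right (P.corner i) (c - P.corner i + P.corner i)
    linarith
  have hs : P.side ≤ Q.side := by
    have i : Fin n := ⟨0, hn⟩
    linarith [(hc i).1, he i]
  intro x hx i
  have h1 := hx i
  have h2 := hc i
  have h3 := he i
  simp only [Cube.triple] at h1 ⊢
  constructor <;> linarith

/-- Maximal dyadic cubes whose fractional average exceeds `τ`. -/
def stopCubes {n : ℕ} (α : ℝ) (g : Rn n → ℝ≥0∞) (τ : ℝ≥0∞) : Set (ℤ × (Fin n → ℤ)) :=
  {i | τ < fracAvg α g (dyCube i.1 i.2) ∧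
    ∀ x ∈ (dyCube i.1 i.2).set, ∀ k > i.1, fracAvg α g (dyCube k (dyIdx k x)) ≤ τ}

lemma exists_stopCube {n : ℕ} (hn : 0 < n) {α : ℝ} (hαn : α < n) {g : Rn n → ℝ≥0∞}
    (hg : ∫⁻ x, g x ≠ ∞) {τ : ℝ≥0∞} (hτ : 0 < τ) {k : ℤ} {x : Rn n}
    (h : τ < fracAvg α g (dyCube k (dyIdx k x))) :
    ∃ i ∈ stopCubes α g τ, k ≤ i.1 ∧ x ∈ (dyCube i.1 i.2).set := by
  have hlim : Filter.Tendsto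
      (fun N : ℕ => ENNReal.ofReal (((2 : ℝ) ^ (α - n)) ^ N) * ∫⁻ x, g x)
      Filter.atTop (nhds (ENNReal.ofReal 0 * ∫⁻ x, g x)) := by
    refine ENNReal.Tendsto.mul_const (ENNReal.tendsto_ofReal ?_) (Or.inr hg)
    refine tendsto_pow_atTop_nhds_zero_of_lt_one (by positivity) ?_
    exact Real.rpow_lt_one_of_one_lt_of_neg (by norm_num) (by linarith)
  simp only [ENNReal.ofReal_zero, zero_mul] at hlim
  obtain ⟨N, hN⟩ := (hlim.eventually (gt_mem_nhds hτ)).exists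
  have hbd : ∀ l : ℤ, τ < fracAvg α g (dyCube l (dyIdx l x)) → l ≤ N := by
    intro l hl
    by_contra! hlN
    refine absurd hl (not_lt.2 (le_trans ?_ hN.le))
    unfold fracAvg
    rw [Cube.vol_rpow_sub_one hn]
    refine mul_le_mul' (ENNReal.ofReal_le_ofReal ?_) (setLIntegral_le_lintegral _ _)
    rw [← Real.rpow_natCast, ← Real.rpow_mul (by norm_num), mul_comm,
      Real.rpow_mul (by norm_num), Real.rpow_natCast]
    refine Real.rpow_le_rpow_of_nonpos (by positivity) ?_ (by linarith)
    simp only [dyCube]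
    rw [← zpow_natCast]
    exact zpow_le_zpow_right₀ (by norm_num) hlN.le
  obtain ⟨l, hl, hmax⟩ := Int.exists_greatest_of_bdd
    (P := fun l => τ < fracAvg α g (dyCube l (dyIdx l x))) ⟨N, hbd⟩ ⟨k, h⟩
  refine ⟨(l, dyIdx l x), ⟨hl, ?_⟩, hmax k h, mem_dyCube.2 rfl⟩
  intro y hy j hj
  rw [dyIdx_congr (le_of_lt hj) (mem_dyCube.1 hy)]
  by_contra! hc
  exact absurd (hmax j hc) (not_le.2 hj)

lemma stopCubes_pairwiseDisjoint {n : ℕ} (α : ℝ) (g : Rn n → ℝ≥0∞) (τ : ℝ≥0∞) :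
    (stopCubes α g τ).PairwiseDisjoint fun i => (dyCube i.1 i.2).set := by
  intro i hi j hj hij
  rw [Function.onFun, Set.disjoint_left]
  intro x hxi hxj
  have hi2 := mem_dyCube.1 hxi
  have hj2 := mem_dyCube.1 hxj
  rcases lt_trichotomy i.1 j.1 with h | h | h
  · have := hi.2 x hxi j.1 h
    rw [hj2] at this
    exact absurd hj.1 (not_lt.2 this)
  · exact hij (Prod.ext h (by rw [← hi2, ← hj2, h]))
  · have := hj.2 x hxj i.1 h
    rw [hi2] at this
    exact absurd hi.1 (not_lt.2 this)

/-- The union of the maximal dyadic cubes at height `τ`. -/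
def stopUnion {n : ℕ} (α : ℝ) (g : Rn n → ℝ≥0∞) (τ : ℝ≥0∞) : Set (Rn n) :=
  ⋃ i ∈ stopCubes α g τ, (dyCube i.1 i.2).set

lemma measurableSet_stopUnion {n : ℕ} (α : ℝ) (g : Rn n → ℝ≥0∞) (τ : ℝ≥0∞) :
    MeasurableSet (stopUnion α g τ) :=
  MeasurableSet.biUnion (to_countable _) fun _ _ => Cube.measurableSet_set _

lemma stopUnion_anti {n : ℕ} (hn : 0 < n) {α : ℝ} (hαn : α < n) {g : Rn n → ℝ≥0∞}
    (hg : ∫⁻ x, g x ≠ ∞) {τ τ' : ℝ≥0∞} (hτ : 0 < τ) (h : τ ≤ τ') :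
    stopUnion α g τ' ⊆ stopUnion α g τ := by
  intro x hx
  simp only [stopUnion, mem_iUnion] at hx ⊢
  obtain ⟨i, hi, hxi⟩ := hx
  have h2 := hi.1
  rw [← mem_dyCube.1 hxi] at h2
  obtain ⟨j, hj, -, hxj⟩ := exists_stopCube hn hαn hg hτ (h.trans_lt h2)
  exact ⟨j, hj, hxj⟩

lemma two_rpow_sub_le {n : ℕ} {α : ℝ} (hα : 0 ≤ α) : (2 : ℝ) ^ ((n : ℝ) - α) ≤ 2 ^ n := by
  rw [← Real.rpow_natCast 2 n]
  exact Real.rpow_le_rpow_of_exponent_le (by norm_num) (by linarith)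

lemma setLIntegral_stopCube_le {n : ℕ} (hn : 0 < n) {α : ℝ} (hα : 0 ≤ α)
    {g : Rn n → ℝ≥0∞} {τ : ℝ≥0∞} {i : ℤ × (Fin n → ℤ)} (hi : i ∈ stopCubes α g τ) :
    ENNReal.ofReal ((dyCube i.1 i.2).vol ^ (α / n)) * ∫⁻ y in (dyCube i.1 i.2).set, g y ≤
      2 ^ n * ENNReal.ofReal (dyCube i.1 i.2).vol * τ := by
  set Q := dyCube i.1 i.2 with hQ
  have hx : Q.corner ∈ Q.set := fun j => ⟨le_rfl, by linarith [Q.side_pos]⟩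
  set P := dyCube (i.1 + 1) (dyIdx (i.1 + 1) Q.corner) with hP
  have hsub : Q.set ⊆ P.set := dyCube_subset (by linarith) hx (mem_dyCube.2 rfl)
  have hPτ : fracAvg α g P ≤ τ := hi.2 _ hx _ (by simp)
  have hside : P.side = 2 * Q.side := by
    simp only [hP, hQ, dyCube]
    rw [zpow_add₀ (by norm_num), zpow_one, mul_comm]
  have hs := Q.side_pos
  have hle : Q.vol ^ (α / n) ≤ 2 ^ n * Q.vol * P.vol ^ (α / n - 1) := by
    rw [Q.vol_rpow hn, P.vol_rpow_sub_one hn, hside, Real.mul_rpow (by norm_num) hs.le, Cube.vol]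
    have h1 : (2 : ℝ) ^ (α - n) * 2 ^ ((n : ℝ) - α) = 1 := by
      rw [← Real.rpow_add (by norm_num)]; simp
    have h2 : Q.side ^ α = Q.side ^ n * Q.side ^ (α - n) := by
      rw [← Real.rpow_natCast, ← Real.rpow_add hs]; simp
    have h3 : 1 ≤ (2 : ℝ) ^ n * 2 ^ (α - n) := by
      rw [← h1, mul_comm]
      gcongr
      exact two_rpow_sub_le hα
    calc Q.side ^ α ≤ ((2 : ℝ) ^ n * 2 ^ (α - n)) * Q.side ^ α :=
          le_mul_of_one_le_left (by positivity) h3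
      _ = _ := by rw [h2]; ring
  calc ENNReal.ofReal (Q.vol ^ (α / n)) * ∫⁻ y in Q.set, g y
      ≤ ENNReal.ofReal (2 ^ n * Q.vol * P.vol ^ (α / n - 1)) * ∫⁻ y in P.set, g y := by
        gcongr
    _ = 2 ^ n * ENNReal.ofReal Q.vol * fracAvg α g P := by
        have := Q.vol_pos
        rw [ENNReal.ofReal_mul (by positivity), ENNReal.ofReal_mul (by positivity), fracAvg,
          ENNReal.ofReal_pow (by norm_num), ENNReal.ofReal_ofNat, mul_assoc]
    _ ≤ _ := by gcongr

lemma volume_stopCube_le {n : ℕ} (hn : 0 < n) {α : ℝ} (hα : 0 ≤ α) (hαn : α < n)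
    {g : Rn n → ℝ≥0∞} (hg : ∫⁻ x, g x ≠ ∞) {τ : ℝ≥0∞} (hτ : 0 < τ) (hτ' : τ ≠ ∞)
    {i : ℤ × (Fin n → ℤ)} (hi : i ∈ stopCubes α g τ) :
    volume (dyCube i.1 i.2).set ≤
      2 * volume ((dyCube i.1 i.2).set \ stopUnion α g (2 ^ (n + 1) * τ)) := by
  set Q := dyCube i.1 i.2 with hQ
  set τ' := 2 ^ (n + 1) * τ with hτ'def
  set U := stopUnion α g τ'
  let J : Set (ℤ × (Fin n → ℤ)) :=
    {j | j ∈ stopCubes α g τ' ∧ (dyCube j.1 j.2).set ⊆ Q.set}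
  have hττ' : τ ≤ τ' := by
    refine le_mul_of_one_le_left (zero_le) ?_
    exact one_le_pow₀ (by norm_num)
  have hcover : Q.set ∩ U ⊆ ⋃ j ∈ J, (dyCube j.1 j.2).set := by
    rintro x ⟨hxQ, hxU⟩
    simp only [U, stopUnion, mem_iUnion] at hxU ⊢
    obtain ⟨j, hj, hxj⟩ := hxU
    have h2 := hj.1
    rw [← mem_dyCube.1 hxj] at h2
    obtain ⟨l, hl, hjl, hxl⟩ := exists_stopCube hn hαn hg hτ (hττ'.trans_lt h2)
    have : l = i := by
      by_contra hne
      exact Set.disjoint_left.1 (stopCubes_pairwiseDisjoint α g τ hl hi hne) hxl hxQ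
    subst this
    exact ⟨j, ⟨hj, dyCube_subset hjl hxj hxl⟩, hxj⟩
  have hterm : ∀ j ∈ J, τ' * volume (dyCube j.1 j.2).set ≤
      ENNReal.ofReal (Q.vol ^ (α / n)) * ∫⁻ y in (dyCube j.1 j.2).set, g y := by
    intro j hj
    set R := dyCube j.1 j.2
    have hvol : R.vol ≤ Q.vol := by
      have := measure_mono (μ := volume) hj.2
      rwa [Cube.volume_set, Cube.volume_set, ENNReal.ofReal_le_ofReal_iff Q.vol_pos.le] at this
    have hR := R.vol_pos
    rw [R.volume_set]
    calc τ' * ENNReal.ofReal R.vol ≤ fracAvg α g R * ENNReal.ofReal R.vol := by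
          gcongr; exact hj.1.1.le
      _ = ENNReal.ofReal (R.vol ^ (α / n)) * ∫⁻ y in R.set, g y := by
          rw [fracAvg, mul_right_comm, ← ENNReal.ofReal_mul (by positivity),
            Real.rpow_sub_one hR.ne', div_mul_cancel₀ _ hR.ne']
      _ ≤ _ := by
          gcongr
  have hsum : τ' * volume (Q.set ∩ U) ≤ τ * 2 ^ n * volume Q.set := by
    calc τ' * volume (Q.set ∩ U) ≤ τ' * ∑' j : J, volume (dyCube j.1.1 j.1.2).set := by
          gcongr
          exact (measure_mono hcover).trans (measure_biUnion_le _ (to_countable _) _)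
      _ = ∑' j : J, τ' * volume (dyCube j.1.1 j.1.2).set := ENNReal.tsum_mul_left.symm
      _ ≤ ∑' j : J, ENNReal.ofReal (Q.vol ^ (α / n)) * ∫⁻ y in (dyCube j.1.1 j.1.2).set, g y :=
          ENNReal.tsum_le_tsum fun j => hterm j j.2
      _ = ENNReal.ofReal (Q.vol ^ (α / n)) * ∑' j : J, ∫⁻ y in (dyCube j.1.1 j.1.2).set, g y :=
          ENNReal.tsum_mul_left
      _ = ENNReal.ofReal (Q.vol ^ (α / n)) * ∫⁻ y in ⋃ j ∈ J, (dyCube j.1 j.2).set, g y := by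
          rw [lintegral_biUnion (to_countable J) (fun _ _ => Cube.measurableSet_set _)
            ((stopCubes_pairwiseDisjoint α g τ').subset fun j hj => hj.1)]
      _ ≤ ENNReal.ofReal (Q.vol ^ (α / n)) * ∫⁻ y in Q.set, g y := by
          gcongr
          exact iUnion₂_subset fun j hj => hj.2
      _ ≤ 2 ^ n * ENNReal.ofReal Q.vol * τ := setLIntegral_stopCube_le hn hα hi
      _ = τ * 2 ^ n * volume Q.set := by rw [Q.volume_set]; ring
  have hhalf : 2 * volume (Q.set ∩ U) ≤ volume Q.set := by
    have h : τ * 2 ^ n * (2 * volume (Q.set ∩ U)) ≤ τ * 2 ^ n * volume Q.set := by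
      refine le_trans (le_of_eq ?_) hsum
      rw [hτ'def]; ring
    refine (ENNReal.mul_le_mul_iff_right ?_ ?_).1 h
    · exact mul_ne_zero hτ.ne' (by simp)
    · exact ENNReal.mul_ne_top hτ' (by simp)
  have hsplit := measure_inter_add_sdiff (μ := volume) Q.set (measurableSet_stopUnion α g τ')
  have hfin : volume (Q.set ∩ U) ≠ ∞ :=
    ne_top_of_le_ne_top (by rw [Q.volume_set]; exact ENNReal.ofReal_ne_top)
      (measure_mono inter_subset_left)
  have hab : volume (Q.set ∩ U) ≤ volume (Q.set \ U) := by
    rw [← hsplit, two_mul] at hhalf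
    exact (ENNReal.add_le_add_iff_left hfin).1 hhalf
  calc volume Q.set = volume (Q.set ∩ U) + volume (Q.set \ U) := hsplit.symm
    _ ≤ volume (Q.set \ U) + volume (Q.set \ U) := by gcongr
    _ = _ := (two_mul _).symm

lemma exists_dyCube_of_lt_fracMax {n : ℕ} (hn : 0 < n) {α : ℝ} (hα : 0 ≤ α) (hαn : α < n)
    {g : Rn n → ℝ≥0∞} {x : Rn n} {t : ℝ≥0∞} (ht : t < fracMax α g x) :
    ∃ k : ℤ, ∃ m : Fin n → ℤ, t < 4 ^ n * fracAvg α g (dyCube k m) ∧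
      x ∈ (dyCube k m).triple.set := by
  simp only [fracMax, lt_iSup_iff] at ht
  obtain ⟨Q, hxQ, hQ⟩ := ht
  change t < fracAvg α g Q at hQ
  obtain ⟨j, hj1, hj2⟩ := exists_mem_Ioc_zpow Q.side_pos (by norm_num : (1 : ℝ) < 2)
  set k := j + 1
  have hk : (2 : ℝ) ^ k = 2 * 2 ^ j := by
    rw [zpow_add₀ (by norm_num), zpow_one, mul_comm]
  have hk0 : (0 : ℝ) < 2 ^ k := by positivity
  let m0 := dyIdx k Q.corner
  let m : (Fin n → Bool) → Fin n → ℤ := fun ε i => m0 i + if ε i then 1 else 0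
  have hm0 : ∀ i, (m0 i : ℝ) * 2 ^ k ≤ Q.corner i ∧ Q.corner i < (m0 i + 1) * 2 ^ k := by
    intro i
    rw [← le_div_iff₀ hk0, ← div_lt_iff₀ hk0]
    exact ⟨Int.floor_le _, Int.lt_floor_add_one _⟩
  have htriple : ∀ ε, x ∈ (dyCube k (m ε)).triple.set := by
    intro ε i
    have h1 := hxQ i
    have h2 := hm0 i
    simp only [Cube.triple, dyCube, m]
    split_ifs <;> push_cast <;> constructor <;> linarith
  by_contra! hcon
  have hcon' : ∀ ε, 4 ^ n * fracAvg α g (dyCube k (m ε)) ≤ t := by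
    intro ε
    by_contra! h
    exact hcon k (m ε) h (htriple ε)
  have hcover : Q.set ⊆ ⋃ ε, (dyCube k (m ε)).set := by
    intro y hy
    rw [mem_iUnion]
    refine ⟨fun i => decide ((m0 i + 1 : ℝ) * 2 ^ k ≤ y i), fun i => ?_⟩
    have h1 := hy i
    have h2 := hm0 i
    simp only [dyCube, m, decide_eq_true_eq]
    split_ifs with h <;> push_cast <;> constructor <;> linarith
  have hside : Q.side ^ (α - n) ≤ 2 ^ n * ((2 : ℝ) ^ k) ^ (α - n) := by
    calc Q.side ^ (α - n) ≤ ((2 : ℝ) ^ j) ^ (α - n) :=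
          Real.rpow_le_rpow_of_nonpos (by positivity) hj1.le (by linarith)
      _ = 2 ^ ((n : ℝ) - α) * ((2 : ℝ) ^ k) ^ (α - n) := by
          rw [hk, Real.mul_rpow (by norm_num) (by positivity), ← mul_assoc,
            ← Real.rpow_add (by norm_num)]
          simp
      _ ≤ _ := by
          gcongr
          exact two_rpow_sub_le hα
  have hsum : fracAvg α g Q ≤ ∑ ε, 2 ^ n * fracAvg α g (dyCube k (m ε)) := by
    calc fracAvg α g Q
        ≤ ENNReal.ofReal (2 ^ n * ((2 : ℝ) ^ k) ^ (α - n)) *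
          ∑ ε, ∫⁻ y in (dyCube k (m ε)).set, g y := by
          rw [fracAvg, Q.vol_rpow_sub_one hn]
          gcongr
          calc ∫⁻ y in Q.set, g y ≤ ∫⁻ y in ⋃ ε, (dyCube k (m ε)).set, g y :=
                lintegral_mono_set hcover
            _ ≤ ∑' ε, ∫⁻ y in (dyCube k (m ε)).set, g y := lintegral_iUnion_le _ _
            _ = _ := tsum_fintype _
      _ = _ := by
          rw [Finset.mul_sum]
          refine Finset.sum_congr rfl fun ε _ => ?_
          rw [fracAvg, Cube.vol_rpow_sub_one hn, ENNReal.ofReal_mul (by positivity),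
            ENNReal.ofReal_pow (by norm_num), ENNReal.ofReal_ofNat, mul_assoc]
          rfl
  have h4 : (4 : ℝ≥0∞) ^ n * fracAvg α g Q ≤ 4 ^ n * t := by
    calc (4 : ℝ≥0∞) ^ n * fracAvg α g Q
        ≤ 4 ^ n * ∑ ε, 2 ^ n * fracAvg α g (dyCube k (m ε)) := by gcongr
      _ = ∑ ε, 2 ^ n * (4 ^ n * fracAvg α g (dyCube k (m ε))) := by
          rw [Finset.mul_sum]
          exact Finset.sum_congr rfl fun ε _ => by ring
      _ ≤ ∑ _ε : Fin n → Bool, 2 ^ n * t := by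
          gcongr with ε
          exact hcon' ε
      _ = 4 ^ n * t := by
          rw [Finset.sum_const, Finset.card_univ, Fintype.card_fun, Fintype.card_bool,
            Fintype.card_fin, nsmul_eq_mul, ← mul_assoc]
          push_cast
          rw [← mul_pow]
          norm_num
  exact absurd ((ENNReal.mul_le_mul_iff_right (by simp) (by simp)).1 h4) (not_le.2 hQ)

lemma measurable_fracMax {n : ℕ} (hn : 0 < n) (α : ℝ) (g : Rn n → ℝ≥0∞) :
    Measurable (fracMax α g) := by
  refine measurable_of_Ioi fun t => IsOpen.measurableSet ?_
  rw [isOpen_iff_mem_nhds]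
  intro x hx
  simp only [mem_preimage, mem_Ioi, fracMax, lt_iSup_iff] at hx
  obtain ⟨Q, hxQ, hQ⟩ := hx
  have hs := Q.side_pos
  have hcont : Filter.Tendsto
      (fun ε : ℝ => ENNReal.ofReal ((Q.side + 2 * ε) ^ (α - n)) * ∫⁻ y in Q.set, g y)
      (nhdsWithin 0 (Ioi 0)) (nhds (ENNReal.ofReal (Q.side ^ (α - n)) * ∫⁻ y in Q.set, g y)) := by
    refine ENNReal.Tendsto.mul_const (ENNReal.tendsto_ofReal ?_) (Or.inl ?_)
    · refine Filter.Tendsto.mono_left ?_ nhdsWithin_le_nhds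
      have : ContinuousAt (fun ε : ℝ => (Q.side + 2 * ε) ^ (α - n)) 0 := by
        refine ContinuousAt.rpow_const (by fun_prop) (Or.inl (by simpa using hs.ne'))
      simpa [ContinuousAt] using this
    · simpa using Real.rpow_pos_of_pos hs _
  rw [Q.vol_rpow_sub_one hn] at hQ
  obtain ⟨ε, hε, hε0⟩ :=
    ((hcont.eventually (lt_mem_nhds hQ)).and self_mem_nhdsWithin).exists
  have hε0 : 0 < ε := hε0
  let R : Cube n := ⟨fun i => Q.corner i - ε, Q.side + 2 * ε, by positivity⟩
  have hsub : Q.set ⊆ R.set := fun y hy i => by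
    have := hy i
    simp only [R]
    constructor <;> linarith
  have hmem : R.set ∈ nhds x := by
    rw [R.set_eq_pi]
    refine set_pi_mem_nhds finite_univ fun i _ => Ico_mem_nhds ?_ ?_
    · have := hxQ i; simp only [R]; linarith
    · have := hxQ i; simp only [R]; linarith
  filter_upwards [hmem] with y hy
  simp only [mem_preimage, mem_Ioi, fracMax, lt_iSup_iff]
  refine ⟨R, hy, hε.trans_le ?_⟩
  rw [R.vol_rpow_sub_one hn]
  gcongr

lemma ofReal_mul_le_young {Φ : ℝ → ℝ} (hΦ : IsYoung Φ) {s t : ℝ} (hs : 0 ≤ s) (ht : 0 ≤ t) :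
    ENNReal.ofReal (s * t) ≤ ENNReal.ofReal (Φ s) + ENNReal.ofReal (assocFn Φ t) := by
  obtain ⟨-, -, hmono, h0, hlim⟩ := hΦ
  rcases hs.eq_or_lt with rfl | hs
  · simp
  have hpos : ∀ r, 0 < r → 0 < Φ r := fun r hr => by
    simpa [h0] using hmono (mem_Ici.2 le_rfl) (mem_Ici.2 hr.le) hr
  have hbdd : BddAbove {y : ℝ | ∃ r : ℝ, 0 < r ∧ y = r * t - Φ r} := by
    obtain ⟨S, hS⟩ := Filter.eventually_atTop.1 (hlim.eventually_ge_atTop t)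
    refine ⟨|S| * t, ?_⟩
    rintro y ⟨r, hr, rfl⟩
    rcases le_total S r with h | h
    · have := (le_div_iff₀ hr).1 (hS r h)
      nlinarith [mul_nonneg (abs_nonneg S) ht]
    · have := hpos r hr
      nlinarith [mul_le_mul_of_nonneg_right (h.trans (le_abs_self S)) ht]
  have hle : s * t - Φ s ≤ assocFn Φ t := le_csSup hbdd ⟨s, hs, rfl⟩
  calc ENNReal.ofReal (s * t) ≤ ENNReal.ofReal (Φ s + assocFn Φ t) :=
        ENNReal.ofReal_le_ofReal (by linarith)
    _ ≤ _ := ENNReal.ofReal_add_le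

lemma IsYoung.measurable_comp_abs_div {n : ℕ} {Φ : ℝ → ℝ} (hΦ : IsYoung Φ) {f : Rn n → ℝ}
    (hf : Measurable f) {l : ℝ} (hl : 0 < l) : Measurable fun x => Φ (|f x| / l) := by
  have hc : Continuous fun y : ℝ => Φ (|y| / l) := by
    refine hΦ.1.comp_continuous (by fun_prop) fun y => ?_
    exact mem_Ici.2 (by positivity)
  exact hc.measurable.comp hf

lemma IsYoung.ae_eq_zero_of_luxNorm_eq_zero {n : ℕ} {Φ : ℝ → ℝ} (hΦ : IsYoung Φ) {Q : Cube n}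
    {f : Rn n → ℝ} (hf : Measurable f) (h : luxNorm Φ Q f = 0) :
    ∀ᵐ x ∂volume.restrict Q.set, f x = 0 := by
  have hmeas : Measurable fun x => ENNReal.ofReal (Φ (|f x|)) := by
    simpa using (hΦ.measurable_comp_abs_div hf one_pos).ennreal_ofReal
  have hint : ∫⁻ x in Q.set, ENNReal.ofReal (Φ (|f x|)) = 0 := by
    refine le_antisymm (ENNReal.le_of_forall_pos_le_add fun ε hε _ => ?_) zero_le
    have hv := Q.vol_pos
    have hδ : 0 < min 1 ((ε : ℝ) / Q.vol) := lt_min one_pos (by positivity)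
    have hlt : luxNorm Φ Q f < ENNReal.ofReal (min 1 ((ε : ℝ) / Q.vol)) := by
      rw [h]; exact ENNReal.ofReal_pos.2 hδ
    obtain ⟨_, ⟨l, ⟨hl, hlQ⟩, rfl⟩, hlt⟩ := sInf_lt_iff.1 hlt
    have hll := (ENNReal.ofReal_lt_ofReal_iff hδ).1 hlt
    have hl1 : l ≤ 1 := hll.le.trans (min_le_left _ _)
    have hl2 : l * Q.vol ≤ ε := (le_div_iff₀ hv).1 (hll.le.trans (min_le_right _ _))
    have hconv : ∀ x, Φ |f x| ≤ l * Φ (|f x| / l) := by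
      intro x
      have := hΦ.2.1.2 (mem_Ici.2 (by positivity : 0 ≤ |f x| / l)) (mem_Ici.2 le_rfl) hl.le
        (sub_nonneg.2 hl1) (by ring)
      simpa [hΦ.2.2.2.1, mul_div_cancel₀ _ hl.ne'] using this
    calc ∫⁻ x in Q.set, ENNReal.ofReal (Φ (|f x|))
        ≤ ∫⁻ x in Q.set, ENNReal.ofReal l * ENNReal.ofReal (Φ (|f x| / l)) := by
          refine lintegral_mono fun x => ?_
          rw [← ENNReal.ofReal_mul hl.le]
          exact ENNReal.ofReal_le_ofReal (hconv x)
      _ = ENNReal.ofReal l * ∫⁻ x in Q.set, ENNReal.ofReal (Φ (|f x| / l)) :=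
          lintegral_const_mul' _ _ ENNReal.ofReal_ne_top
      _ ≤ ENNReal.ofReal l * ENNReal.ofReal Q.vol := by gcongr
      _ = ENNReal.ofReal (l * Q.vol) := (ENNReal.ofReal_mul hl.le).symm
      _ ≤ ENNReal.ofReal ε := ENNReal.ofReal_le_ofReal hl2
      _ = 0 + ε := by simp
  filter_upwards [(lintegral_eq_zero_iff hmeas).1 hint] with x hx
  by_contra hne
  have hp : 0 < Φ |f x| := by
    simpa [hΦ.2.2.2.1] using
      hΦ.2.2.1 (mem_Ici.2 le_rfl) (mem_Ici.2 (abs_nonneg (f x))) (abs_pos.2 hne)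
  simp only [Pi.zero_apply, ENNReal.ofReal_eq_zero] at hx
  linarith

/-- The generalized Hölder inequality for Luxemburg averages. -/
lemma lintegral_mul_le_luxNorm {n : ℕ} {Φ : ℝ → ℝ} (hΦ : IsYoung Φ) {Q : Cube n}
    {f g : Rn n → ℝ} (hf : Measurable f) (h0 : luxNorm Φ Q f ≠ 0) (h1 : luxNorm Φ Q f ≠ ∞) :
    ∫⁻ x in Q.set, ENNReal.ofReal (|f x| * |g x|) ≤
      2 * ENNReal.ofReal Q.vol * luxNorm Φ Q f * luxNorm (assocFn Φ) Q g := by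
  set V := ENNReal.ofReal Q.vol with hV
  have hV0 : V ≠ 0 := (ENNReal.ofReal_pos.2 Q.vol_pos).ne'
  have hVt : V ≠ ∞ := ENNReal.ofReal_ne_top
  set I := ∫⁻ x in Q.set, ENNReal.ofReal (|f x| * |g x|) with hI
  have key : ∀ l : ℝ, 0 < l → (∫⁻ x in Q.set, ENNReal.ofReal (Φ (|f x| / l))) ≤ V →
      ∀ r : ℝ, 0 < r → (∫⁻ x in Q.set, ENNReal.ofReal (assocFn Φ (|g x| / r))) ≤ V →
      I ≤ 2 * V * ENNReal.ofReal l * ENNReal.ofReal r := by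
    intro l hl hlQ r hr hrQ
    calc I ≤ ∫⁻ x in Q.set, ENNReal.ofReal (l * r) *
          (ENNReal.ofReal (Φ (|f x| / l)) + ENNReal.ofReal (assocFn Φ (|g x| / r))) := by
          refine lintegral_mono fun x => ?_
          have : |f x| * |g x| = (l * r) * (|f x| / l * (|g x| / r)) := by field_simp
          simp only [this]
          rw [ENNReal.ofReal_mul (by positivity)]
          gcongr
          exact ofReal_mul_le_young hΦ (by positivity) (by positivity)
      _ = ENNReal.ofReal (l * r) * ((∫⁻ x in Q.set, ENNReal.ofReal (Φ (|f x| / l))) +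
          ∫⁻ x in Q.set, ENNReal.ofReal (assocFn Φ (|g x| / r))) := by
          rw [lintegral_const_mul' _ _ ENNReal.ofReal_ne_top, lintegral_add_left]
          exact (hΦ.measurable_comp_abs_div hf hl).ennreal_ofReal
      _ ≤ ENNReal.ofReal (l * r) * (V + V) := by gcongr
      _ = _ := by rw [ENNReal.ofReal_mul hl.le]; ring
  set N := luxNorm Φ Q f with hN
  have hN2 : ∀ r : ℝ, 0 < r → (∫⁻ x in Q.set, ENNReal.ofReal (assocFn Φ (|g x| / r))) ≤ V →
      I ≤ 2 * V * N * ENNReal.ofReal r := by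
    intro r hr hrQ
    have hr0 : ENNReal.ofReal r ≠ 0 := (ENNReal.ofReal_pos.2 hr).ne'
    have hc0 : 2 * V * ENNReal.ofReal r ≠ 0 := mul_ne_zero (mul_ne_zero two_ne_zero hV0) hr0
    have hct : 2 * V * ENNReal.ofReal r ≠ ∞ :=
      ENNReal.mul_ne_top (ENNReal.mul_ne_top (by simp) hVt) ENNReal.ofReal_ne_top
    have : I / (2 * V * ENNReal.ofReal r) ≤ N := by
      refine le_sInf ?_
      rintro _ ⟨l, ⟨hl, hlQ⟩, rfl⟩
      rw [ENNReal.div_le_iff hc0 hct]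
      exact (key l hl hlQ r hr hrQ).trans_eq (by ring)
    rw [ENNReal.div_le_iff hc0 hct] at this
    exact this.trans_eq (by ring)
  have hc0 : 2 * V * N ≠ 0 := mul_ne_zero (mul_ne_zero two_ne_zero hV0) h0
  have hct : 2 * V * N ≠ ∞ := ENNReal.mul_ne_top (ENNReal.mul_ne_top (by simp) hVt) h1
  have : I / (2 * V * N) ≤ luxNorm (assocFn Φ) Q g := by
    refine le_sInf ?_
    rintro _ ⟨r, ⟨hr, hrQ⟩, rfl⟩
    rw [ENNReal.div_le_iff hc0 hct]
    exact (hN2 r hr hrQ).trans_eq (by ring)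
  rw [ENNReal.div_le_iff hc0 hct] at this
  exact this.trans_eq (by ring)

lemma mulW_eq_ofReal_mul {n : ℕ} {p : ℝ} (hp : 1 < p) {f : Rn n → ℝ≥0∞} {σ : Rn n → ℝ}
    (hσ : ∀ x, 0 ≤ σ x) {x : Rn n} (hf : f x ≠ ∞) :
    mulW f σ x = ENNReal.ofReal (|σ x ^ (1 / conjExp p)| * |(f x).toReal * σ x ^ (1 / p)|) := by
  have h : 1 / p + 1 / conjExp p = 1 := by
    have h1 : p ≠ 0 := by positivity
    have h2 : p - 1 ≠ 0 := by linarith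
    rw [conjExp]
    field_simp
    ring
  have hx := hσ x
  rw [abs_of_nonneg (by positivity), abs_of_nonneg (by positivity), mul_left_comm, mul_comm (_ ^ _),
    ← Real.rpow_add' hx (by rw [h]; norm_num), h, Real.rpow_one,
    ENNReal.ofReal_mul ENNReal.toReal_nonneg, ENNReal.ofReal_toReal hf]
  rfl

lemma fracAvg_mul_le_bumpA {n : ℕ} (hn : 0 < n) {α p q : ℝ} (hp : 1 < p) (hq : 0 < q)
    {Φ : ℝ → ℝ} (hΦ : IsYoung Φ) {u σ : Rn n → ℝ} (hσ : Measurable σ) (hσ0 : ∀ x, 0 ≤ σ x)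
    (hA : bumpA α p q Φ u σ < ∞) {f : Rn n → ℝ≥0∞} (hf : ∀ x, f x ≠ ∞) (Q : Cube n) :
    fracAvg α (mulW f σ) Q * (∫⁻ x in Q.set, ENNReal.ofReal (u x)) ^ (1 / q) ≤
      2 * bumpA α p q Φ u σ * ENNReal.ofReal Q.vol ^ (1 / q) *
        (ENNReal.ofReal (Q.vol ^ (n * (1 / p - 1 / q) / n)) *
          luxNorm (assocFn Φ) Q fun x => (f x).toReal * σ x ^ (1 / p)) := by
  have hn' : (n : ℝ) ≠ 0 := by positivity
  have hV := Q.vol_pos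
  have hV0 : ENNReal.ofReal Q.vol ≠ 0 := (ENNReal.ofReal_pos.2 hV).ne'
  have hVt : ENNReal.ofReal Q.vol ≠ ∞ := ENNReal.ofReal_ne_top
  have hofr : ∀ a : ℝ, ENNReal.ofReal (Q.vol ^ a) = ENNReal.ofReal Q.vol ^ a := fun a =>
    (ENNReal.ofReal_rpow_of_pos hV).symm
  have hσm : Measurable fun x => σ x ^ (1 / conjExp p) := hσ.pow_const _
  set B := ENNReal.ofReal (Q.vol ^ (α / n + 1 / q - 1 / p)) * avgW Q u ^ (1 / q) with hB
  set N := luxNorm Φ Q fun x => σ x ^ (1 / conjExp p) with hN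
  have hBN : B * N ≤ bumpA α p q Φ u σ := le_iSup (fun Q : Cube n =>
    ENNReal.ofReal (Q.vol ^ (α / n + 1 / q - 1 / p)) * avgW Q u ^ (1 / q) *
      luxNorm Φ Q (fun x => σ x ^ (1 / conjExp p))) Q
  have hL : fracAvg α (mulW f σ) Q * (∫⁻ x in Q.set, ENNReal.ofReal (u x)) ^ (1 / q) =
      B * ENNReal.ofReal Q.vol ^ (1 / p - 1) * ∫⁻ x in Q.set, mulW f σ x := by
    have e : ENNReal.ofReal Q.vol ^ (α / n - 1) =
        ENNReal.ofReal Q.vol ^ (α / n + 1 / q - 1 / p) * (ENNReal.ofReal Q.vol ^ (1 / q))⁻¹ *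
          ENNReal.ofReal Q.vol ^ (1 / p - 1) := by
      rw [← ENNReal.rpow_neg, ← ENNReal.rpow_add _ _ hV0 hVt, ← ENNReal.rpow_add _ _ hV0 hVt]
      congr 1
      ring
    rw [hB, avgW, avgE, ENNReal.div_rpow_of_nonneg _ _ (by positivity), fracAvg, hofr, hofr, e,
      ENNReal.div_eq_inv_mul]
    ring
  rw [hL]
  rcases eq_or_ne N ∞ with hNt | hNt
  · have : B = 0 := by
      by_contra hB0
      rw [hNt, ENNReal.mul_top hB0] at hBN
      exact absurd hA (not_lt.2 hBN)
    rw [this, zero_mul, zero_mul]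
    exact zero_le
  rcases eq_or_ne N 0 with hN0 | hN0
  · have hz : ∫⁻ x in Q.set, mulW f σ x = 0 := by
      refine (lintegral_congr_ae ?_).trans lintegral_zero
      filter_upwards [hΦ.ae_eq_zero_of_luxNorm_eq_zero hσm hN0] with x hx
      rw [mulW_eq_ofReal_mul hp hσ0 (hf x), hx]
      simp
    rw [hz, mul_zero]
    exact zero_le
  have hI : ∫⁻ x in Q.set, mulW f σ x ≤ 2 * ENNReal.ofReal Q.vol * N *
      luxNorm (assocFn Φ) Q fun x => (f x).toReal * σ x ^ (1 / p) := by
    simp_rw [fun x => mulW_eq_ofReal_mul hp hσ0 (hf x)]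
    exact lintegral_mul_le_luxNorm hΦ hσm hN0 hNt
  set L := luxNorm (assocFn Φ) Q fun x => (f x).toReal * σ x ^ (1 / p)
  have e2 : ENNReal.ofReal Q.vol ^ (1 / p - 1) * ENNReal.ofReal Q.vol =
      ENNReal.ofReal Q.vol ^ (1 / q) * ENNReal.ofReal (Q.vol ^ (n * (1 / p - 1 / q) / n)) := by
    rw [hofr, ← ENNReal.rpow_add _ _ hV0 hVt]
    nth_rw 2 [← ENNReal.rpow_one (ENNReal.ofReal Q.vol)]
    rw [← ENNReal.rpow_add _ _ hV0 hVt]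
    congr 1
    field_simp
    ring
  calc B * ENNReal.ofReal Q.vol ^ (1 / p - 1) * ∫⁻ x in Q.set, mulW f σ x
      ≤ B * ENNReal.ofReal Q.vol ^ (1 / p - 1) * (2 * ENNReal.ofReal Q.vol * N * L) := by gcongr
    _ = 2 * (B * N) * (ENNReal.ofReal Q.vol ^ (1 / p - 1) * ENNReal.ofReal Q.vol) * L := by ring
    _ ≤ 2 * bumpA α p q Φ u σ *
        (ENNReal.ofReal Q.vol ^ (1 / p - 1) * ENNReal.ofReal Q.vol) * L := by gcongr
    _ = _ := by rw [e2]; ring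

lemma fracAvg_le_triple {n : ℕ} (hn : 0 < n) {α : ℝ} (hα : 0 ≤ α) (g : Rn n → ℝ≥0∞)
    (Q : Cube n) : fracAvg α g Q ≤ 3 ^ n * fracAvg α g Q.triple := by
  have hs := Q.side_pos
  have h : Q.side ^ (α - n) ≤ 3 ^ n * (3 * Q.side) ^ (α - n) := by
    have h1 : (3 : ℝ) ^ ((n : ℝ) - α) ≤ 3 ^ n := by
      rw [← Real.rpow_natCast 3 n]
      exact Real.rpow_le_rpow_of_exponent_le (by norm_num) (by linarith)
    calc Q.side ^ (α - n) = 3 ^ ((n : ℝ) - α) * (3 * Q.side) ^ (α - n) := by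
          rw [Real.mul_rpow (by norm_num) hs.le, ← mul_assoc, ← Real.rpow_add (by norm_num)]
          simp
      _ ≤ _ := by gcongr
  rw [fracAvg, fracAvg, Q.vol_rpow_sub_one hn, Cube.vol_rpow_sub_one hn, ← mul_assoc]
  have h3 : (3 : ℝ≥0∞) ^ n = ENNReal.ofReal (3 ^ n) := by
    rw [ENNReal.ofReal_pow (by norm_num), ENNReal.ofReal_ofNat]
  rw [h3, ← ENNReal.ofReal_mul (by positivity)]
  gcongr
  · exact h
  · exact Q.subset_triple

lemma Cube.vol_triple {n : ℕ} (Q : Cube n) : Q.triple.vol = 3 ^ n * Q.vol := by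
  simp [Cube.vol, Cube.triple, mul_pow]

lemma stopCube_weight_le {n : ℕ} (hn : 0 < n) {α p q : ℝ} (hα : 0 ≤ α) (hαn : α < n)
    (hp : 1 < p) (hq : 0 < q) {Φ : ℝ → ℝ} (hΦ : IsYoung Φ) {u σ : Rn n → ℝ}
    (hσ : Measurable σ) (hσ0 : ∀ x, 0 ≤ σ x) (hA : bumpA α p q Φ u σ < ∞)
    {f : Rn n → ℝ≥0∞} (hf : ∀ x, f x ≠ ∞) (hg : ∫⁻ x, mulW f σ x ≠ ∞)
    {τ : ℝ≥0∞} (hτ : 0 < τ) (hτ' : τ ≠ ∞) {i : ℤ × (Fin n → ℤ)}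
    (hi : i ∈ stopCubes α (mulW f σ) τ) :
    τ ^ q * ∫⁻ x in (dyCube i.1 i.2).triple.set, ENNReal.ofReal (u x) ≤
      (3 ^ n * 2 * bumpA α p q Φ u σ) ^ q * (3 ^ n * 2) *
        ∫⁻ x in (dyCube i.1 i.2).set \ stopUnion α (mulW f σ) (2 ^ (n + 1) * τ),
          orliczMax (n * (1 / p - 1 / q)) (assocFn Φ)
            (fun x => (f x).toReal * σ x ^ (1 / p)) x ^ q := by
  set Q := dyCube i.1 i.2
  set E := Q.set \ stopUnion α (mulW f σ) (2 ^ (n + 1) * τ)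
  set A := bumpA α p q Φ u σ
  set h : Rn n → ℝ := fun x => (f x).toReal * σ x ^ (1 / p)
  set c := ENNReal.ofReal (Q.triple.vol ^ (n * (1 / p - 1 / q) / n)) *
    luxNorm (assocFn Φ) Q.triple h
  have hE : MeasurableSet E := Q.measurableSet_set.diff (measurableSet_stopUnion _ _ _)
  have hroot : ∀ a : ℝ≥0∞, (a ^ (1 / q)) ^ q = a := fun a => by
    rw [← ENNReal.rpow_mul, one_div_mul_cancel hq.ne', ENNReal.rpow_one]
  have hvol : ENNReal.ofReal Q.triple.vol ≤ 3 ^ n * 2 * volume E := by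
    rw [Q.vol_triple, ENNReal.ofReal_mul (by positivity), ENNReal.ofReal_pow (by norm_num),
      ENNReal.ofReal_ofNat, ← Q.volume_set, mul_assoc]
    gcongr
    exact volume_stopCube_le hn hα hαn hg hτ hτ' hi
  have hmax : c ^ q * volume E ≤ ∫⁻ x in E, orliczMax (n * (1 / p - 1 / q)) (assocFn Φ) h x ^ q := by
    rw [← setLIntegral_const]
    refine setLIntegral_mono' hE fun x hx => ?_
    gcongr
    exact le_iSup₂ (f := fun (R : Cube n) (_ : x ∈ R.set) =>
      ENNReal.ofReal (R.vol ^ (n * (1 / p - 1 / q) / n)) * luxNorm (assocFn Φ) R h)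
      Q.triple (Q.subset_triple hx.1)
  have hmain : τ * (∫⁻ x in Q.triple.set, ENNReal.ofReal (u x)) ^ (1 / q) ≤
      3 ^ n * (2 * A * ENNReal.ofReal Q.triple.vol ^ (1 / q) * c) := by
    calc τ * (∫⁻ x in Q.triple.set, ENNReal.ofReal (u x)) ^ (1 / q)
        ≤ 3 ^ n * fracAvg α (mulW f σ) Q.triple *
          (∫⁻ x in Q.triple.set, ENNReal.ofReal (u x)) ^ (1 / q) := by
          gcongr
          exact hi.1.le.trans (fracAvg_le_triple hn hα _ _)
      _ ≤ _ := by
          rw [mul_assoc]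
          refine mul_le_mul' le_rfl ?_
          exact fracAvg_mul_le_bumpA hn hp hq hΦ hσ hσ0 hA hf _
  calc τ ^ q * ∫⁻ x in Q.triple.set, ENNReal.ofReal (u x)
      = (τ * (∫⁻ x in Q.triple.set, ENNReal.ofReal (u x)) ^ (1 / q)) ^ q := by
        rw [ENNReal.mul_rpow_of_nonneg _ _ hq.le, hroot]
    _ ≤ (3 ^ n * (2 * A * ENNReal.ofReal Q.triple.vol ^ (1 / q) * c)) ^ q := by gcongr
    _ = ((3 ^ n * 2 * A) * ENNReal.ofReal Q.triple.vol ^ (1 / q) * c) ^ q := by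
        congr 1; ring
    _ = (3 ^ n * 2 * A) ^ q * ENNReal.ofReal Q.triple.vol * c ^ q := by
        rw [ENNReal.mul_rpow_of_nonneg _ _ hq.le, ENNReal.mul_rpow_of_nonneg _ _ hq.le, hroot]
    _ ≤ (3 ^ n * 2 * A) ^ q * (3 ^ n * 2 * volume E) * c ^ q := by gcongr
    _ = (3 ^ n * 2 * A) ^ q * (3 ^ n * 2) * (c ^ q * volume E) := by ring
    _ ≤ _ := by gcongr

lemma fracMax_rpow_le_tsum {n : ℕ} (hn : 0 < n) {α q : ℝ} (hα : 0 ≤ α) (hαn : α < n)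
    (hq : 0 < q) {g : Rn n → ℝ≥0∞} (hg : ∫⁻ x, g x ≠ ∞) {b : ℝ≥0∞} (hb : 1 < b) (hb' : b ≠ ∞)
    (x : Rn n) :
    fracMax α g x ^ q ≤ ∑' k : ℤ, ∑' i : stopCubes α g (b ^ k),
      (dyCube i.1.1 i.1.2).triple.set.indicator
        (fun _ => (4 ^ n * b) ^ q * (b ^ k) ^ q) x := by
  rw [← ENNReal.le_rpow_inv_iff hq]
  refine le_of_forall_lt_imp_le_of_dense fun t ht => ?_
  rw [ENNReal.le_rpow_inv_iff hq]
  rcases eq_or_ne t 0 with rfl | ht0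
  · rw [ENNReal.zero_rpow_of_pos hq]
    exact zero_le
  have hb0 : b ≠ 0 := (zero_lt_one.trans hb).ne'
  have h40 : (4 : ℝ≥0∞) ^ n ≠ 0 := by simp
  have h4t : (4 : ℝ≥0∞) ^ n ≠ ∞ := by simp
  obtain ⟨k, hk1, hk2⟩ := ENNReal.exists_mem_Ioc_zpow
    (ENNReal.div_ne_zero.2 ⟨ht0, h4t⟩) (ENNReal.div_ne_top (ne_top_of_lt ht) h40) hb hb'
  rw [ENNReal.div_le_iff h40 h4t] at hk2
  obtain ⟨l, m, hlm, hx⟩ := exists_dyCube_of_lt_fracMax hn hα hαn ht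
  set P := dyCube l m with hP
  have hc : P.corner ∈ P.set := fun j => ⟨le_rfl, by linarith [P.side_pos]⟩
  have hlt : b ^ k < fracAvg α g (dyCube l (dyIdx l P.corner)) := by
    rw [mem_dyCube.1 hc]
    refine hk1.trans ?_
    rw [ENNReal.div_lt_iff (Or.inl h40) (Or.inl h4t), mul_comm]
    exact hlm
  obtain ⟨i, hi, hli, hci⟩ := exists_stopCube hn hαn hg (ENNReal.zpow_pos hb0 hb' k) hlt
  have hxi : x ∈ (dyCube i.1 i.2).triple.set :=
    Cube.triple_mono hn (dyCube_subset hli hc hci) hx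
  refine le_trans ?_ (ENNReal.le_tsum k)
  refine le_trans ?_ (ENNReal.le_tsum (⟨i, hi⟩ : stopCubes α g (b ^ k)))
  rw [indicator_of_mem hxi, ← ENNReal.mul_rpow_of_nonneg _ _ hq.le]
  gcongr
  refine hk2.trans_eq ?_
  rw [ENNReal.zpow_add hb0 hb', zpow_one]
  ring

lemma tsum_stopCube_le {n : ℕ} (hn : 0 < n) {α : ℝ} (hαn : α < n) {g : Rn n → ℝ≥0∞}
    (hg : ∫⁻ x, g x ≠ ∞) {b : ℝ≥0∞} (hb : 1 < b) (hb' : b ≠ ∞) (F : Rn n → ℝ≥0∞) :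
    ∑' k : ℤ, ∑' i : stopCubes α g (b ^ k),
      ∫⁻ x in (dyCube i.1.1 i.1.2).set \ stopUnion α g (b * b ^ k), F x ≤ ∫⁻ x, F x := by
  have hb0 : b ≠ 0 := (zero_lt_one.trans hb).ne'
  have hstep : ∀ k : ℤ, b * b ^ k = b ^ (k + 1) := fun k => by
    rw [ENNReal.zpow_add hb0 hb', zpow_one, mul_comm]
  simp_rw [hstep]
  set W : ℤ → Set (Rn n) := fun k => stopUnion α g (b ^ k) \ stopUnion α g (b ^ (k + 1)) with hW
  have hWm : ∀ k, MeasurableSet (W k) := fun k =>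
    (measurableSet_stopUnion _ _ _).diff (measurableSet_stopUnion _ _ _)
  have hlt : ∀ k l : ℤ, k < l → Disjoint (W k) (W l) := by
    intro k l hkl
    rw [Set.disjoint_left]
    rintro x ⟨-, hx⟩ ⟨hx', -⟩
    exact hx (stopUnion_anti hn hαn hg (ENNReal.zpow_pos hb0 hb' _)
      (ENNReal.zpow_le_of_le hb.le (by linarith [Int.add_one_le_iff.2 hkl])) hx')
  have hdisj : Pairwise (Function.onFun Disjoint W) := by
    intro k l hkl
    rcases lt_or_gt_of_ne hkl with h | h
    · exact hlt k l h
    · exact (hlt l k h).symm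
  have hinner : ∀ k : ℤ, ∑' i : stopCubes α g (b ^ k),
      ∫⁻ x in (dyCube i.1.1 i.1.2).set \ stopUnion α g (b ^ (k + 1)), F x =
        ∫⁻ x in W k, F x := by
    intro k
    have hWk : W k = ⋃ i ∈ stopCubes α g (b ^ k),
        (dyCube i.1 i.2).set \ stopUnion α g (b ^ (k + 1)) := by
      simp only [hW]
      rw [stopUnion]
      simp only [iUnion_sdiff]
    rw [hWk, lintegral_biUnion (to_countable _)]
    · exact fun i _ => (Cube.measurableSet_set _).diff (measurableSet_stopUnion _ _ _)
    · exact fun i hi j hj hij => ((stopCubes_pairwiseDisjoint α g (b ^ k)) hi hj hij).mono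
        sdiff_subset sdiff_subset
  simp_rw [hinner]
  rw [← lintegral_iUnion hWm hdisj]
  exact setLIntegral_le_lintegral _ _

/-- The constant in the `q`-th power of the bump inequality. -/
def bumpConst (n : ℕ) (q : ℝ) : ℝ≥0∞ :=
  4 ^ n * 2 ^ (n + 1) * (3 ^ n * 2) * (3 ^ n * 2) ^ (1 / q)

lemma LpW_fracMax_le_orliczMax {n : ℕ} (hn : 0 < n) {α p q : ℝ} (hα : 0 ≤ α) (hαn : α < n)
    (hp : 1 < p) (hq : 0 < q) {Φ : ℝ → ℝ} (hΦ : IsYoung Φ) {u σ : Rn n → ℝ}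
    (hu : Measurable u) (hσ : Measurable σ) (hσ0 : ∀ x, 0 ≤ σ x)
    (hA : bumpA α p q Φ u σ < ∞) {f : Rn n → ℝ≥0∞} (hf : ∀ x, f x ≠ ∞)
    (hg : ∫⁻ x, mulW f σ x ≠ ∞) :
    LpW (fracMax α (mulW f σ)) q u ≤ bumpConst n q * bumpA α p q Φ u σ *
      LpE (orliczMax (n * (1 / p - 1 / q)) (assocFn Φ)
        (fun x => (f x).toReal * σ x ^ (1 / p))) q := by
  set g := mulW f σ
  set A := bumpA α p q Φ u σ
  set G := orliczMax (n * (1 / p - 1 / q)) (assocFn Φ) (fun x => (f x).toReal * σ x ^ (1 / p))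
  set b : ℝ≥0∞ := 2 ^ (n + 1) with hbdef
  have hb : 1 < b := one_lt_pow₀ (by norm_num) (by omega)
  have hb' : b ≠ ∞ := by simp [hbdef]
  have hb0 : b ≠ 0 := (zero_lt_one.trans hb).ne'
  have hint : ∫⁻ x, fracMax α g x ^ q * ENNReal.ofReal (u x) ≤
      (4 ^ n * b) ^ q * ((3 ^ n * 2 * A) ^ q * (3 ^ n * 2)) * ∫⁻ x, G x ^ q := by
    have hmeas : ∀ (k : ℤ) (i : stopCubes α g (b ^ k)), Measurable fun x =>
        (dyCube i.1.1 i.1.2).triple.set.indicator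
          (fun _ => (4 ^ n * b) ^ q * (b ^ k) ^ q) x * ENNReal.ofReal (u x) := fun k i =>
      (measurable_const.indicator (Cube.measurableSet_set _)).mul hu.ennreal_ofReal
    calc ∫⁻ x, fracMax α g x ^ q * ENNReal.ofReal (u x)
        ≤ ∫⁻ x, ∑' k : ℤ, ∑' i : stopCubes α g (b ^ k),
          (dyCube i.1.1 i.1.2).triple.set.indicator
            (fun _ => (4 ^ n * b) ^ q * (b ^ k) ^ q) x * ENNReal.ofReal (u x) := by
          refine lintegral_mono fun x => ?_
          simp_rw [ENNReal.tsum_mul_right]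
          gcongr
          exact fracMax_rpow_le_tsum hn hα hαn hq hg hb hb' x
      _ = ∑' k : ℤ, ∑' i : stopCubes α g (b ^ k), ∫⁻ x,
          (dyCube i.1.1 i.1.2).triple.set.indicator
            (fun _ => (4 ^ n * b) ^ q * (b ^ k) ^ q) x * ENNReal.ofReal (u x) := by
          rw [lintegral_tsum fun k => (Measurable.tsum fun i => hmeas k i).aemeasurable]
          exact tsum_congr fun k => lintegral_tsum fun i => (hmeas k i).aemeasurable
      _ = ∑' k : ℤ, ∑' i : stopCubes α g (b ^ k), (4 ^ n * b) ^ q * ((b ^ k) ^ q *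
          ∫⁻ x in (dyCube i.1.1 i.1.2).triple.set, ENNReal.ofReal (u x)) := by
          refine tsum_congr fun k => tsum_congr fun i => ?_
          rw [← mul_assoc, ← lintegral_const_mul _ hu.ennreal_ofReal,
            ← lintegral_indicator (Cube.measurableSet_set _)]
          refine lintegral_congr fun x => ?_
          simp only [indicator]
          split_ifs <;> simp
      _ ≤ ∑' k : ℤ, ∑' i : stopCubes α g (b ^ k), (4 ^ n * b) ^ q *
          (((3 ^ n * 2 * A) ^ q * (3 ^ n * 2)) *
          ∫⁻ x in (dyCube i.1.1 i.1.2).set \ stopUnion α g (b * b ^ k), G x ^ q) := by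
          refine ENNReal.tsum_le_tsum fun k => ENNReal.tsum_le_tsum fun i => ?_
          refine mul_le_mul' le_rfl ?_
          exact stopCube_weight_le hn hα hαn hp hq hΦ hσ hσ0 hA hf hg
            (ENNReal.zpow_pos hb0 hb' k) (ENNReal.zpow_ne_top hb0 hb' k) i.2
      _ = (4 ^ n * b) ^ q * ((3 ^ n * 2 * A) ^ q * (3 ^ n * 2)) *
          ∑' k : ℤ, ∑' i : stopCubes α g (b ^ k),
          ∫⁻ x in (dyCube i.1.1 i.1.2).set \ stopUnion α g (b * b ^ k), G x ^ q := by
          simp_rw [ENNReal.tsum_mul_left, mul_assoc]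
      _ ≤ _ := by
          gcongr
          exact tsum_stopCube_le hn hαn hg hb hb' _
  have hq' : 0 ≤ 1 / q := by positivity
  have hroot : ∀ a : ℝ≥0∞, (a ^ q) ^ (1 / q) = a := fun a => by
    rw [← ENNReal.rpow_mul, mul_one_div_cancel hq.ne', ENNReal.rpow_one]
  calc LpW (fracMax α g) q u
      ≤ ((4 ^ n * b) ^ q * ((3 ^ n * 2 * A) ^ q * (3 ^ n * 2)) * ∫⁻ x, G x ^ q) ^ (1 / q) :=
        ENNReal.rpow_le_rpow hint hq'
    _ = _ := by
        rw [ENNReal.mul_rpow_of_nonneg _ _ hq', ENNReal.mul_rpow_of_nonneg _ _ hq',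
          ENNReal.mul_rpow_of_nonneg _ (3 ^ n * 2) hq', hroot, hroot, bumpConst, LpE]
        ring

lemma LpW_fracMax_le_of_integrable {n : ℕ} (hn : 0 < n) {α p q : ℝ} (hα : 0 ≤ α)
    (hαn : α < n) (hp : 1 < p) (hq : 0 < q) {Φ : ℝ → ℝ} (hΦ : IsYoung Φ) {u σ : Rn n → ℝ}
    (hu : Measurable u) (hσ : Measurable σ) (hσ0 : ∀ x, 0 ≤ σ x)
    (hA : bumpA α p q Φ u σ < ∞) {f : Rn n → ℝ≥0∞} (hfm : Measurable f) (hf : ∀ x, f x ≠ ∞)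
    (hg : ∫⁻ x, mulW f σ x ≠ ∞) (hfp : LpW f p σ ≠ ∞) :
    LpW (fracMax α (mulW f σ)) q u ≤ bumpConst n q * bumpA α p q Φ u σ *
      orliczMaxNorm n (n * (1 / p - 1 / q)) (assocFn Φ) p q * LpW f p σ := by
  have hp0 : 0 < p := by linarith
  rcases eq_or_ne (LpW f p σ) 0 with h0 | h0
  · have hz : ∫⁻ x, mulW f σ x = 0 := by
      have h1 : ∫⁻ x, f x ^ p * ENNReal.ofReal (σ x) = 0 := by
        simpa [LpW, hp0, hp0.le, not_lt.2 hp0.le] using h0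
      have h2 := (lintegral_eq_zero_iff (show Measurable fun x => f x ^ p * ENNReal.ofReal (σ x)
        from (hfm.pow_const _).mul hσ.ennreal_ofReal)).1 h1
      refine (lintegral_congr_ae ?_).trans lintegral_zero
      filter_upwards [h2] with x hx
      rcases mul_eq_zero.1 hx with hx | hx
      · rw [ENNReal.rpow_eq_zero_iff_of_pos hp0] at hx
        simp [mulW, hx]
      · simp [mulW, hx]
    have hM : ∀ x, fracMax α (mulW f σ) x = 0 := by
      intro x
      have : ∀ Q : Cube n, ∫⁻ y in Q.set, mulW f σ y = 0 := fun Q =>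
        le_antisymm ((setLIntegral_le_lintegral _ _).trans_eq hz) zero_le
      simp [fracMax, this]
    have : LpW (fracMax α (mulW f σ)) q u = 0 := by
      simp [LpW, hM, hq]
    rw [this]
    exact zero_le
  set h : Rn n → ℝ := fun x => (f x).toReal * σ x ^ (1 / p) with hh
  have hhm : Measurable h := hfm.ennreal_toReal.mul (hσ.pow_const _)
  have hhp : Lp0 h p = LpW f p σ := by
    rw [Lp0, LpW]
    congr 1
    refine lintegral_congr fun x => ?_
    have hx := hσ0 x
    rw [hh, abs_of_nonneg (by positivity), ENNReal.ofReal_mul ENNReal.toReal_nonneg,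
      ENNReal.ofReal_toReal (hf x), ENNReal.mul_rpow_of_nonneg _ _ hp0.le,
      ENNReal.ofReal_rpow_of_nonneg (by positivity) hp0.le, ← Real.rpow_mul hx,
      one_div_mul_cancel hp0.ne', Real.rpow_one]
  have hN : LpE (orliczMax (n * (1 / p - 1 / q)) (assocFn Φ) h) q ≤
      orliczMaxNorm n (n * (1 / p - 1 / q)) (assocFn Φ) p q * LpW f p σ := by
    rw [← ENNReal.div_le_iff h0 hfp, ← hhp]
    exact le_iSup₂ (f := fun (h : Rn n → ℝ) (_ : Measurable h) =>
      LpE (orliczMax (n * (1 / p - 1 / q)) (assocFn Φ) h) q / Lp0 h p) h hhm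
  refine (LpW_fracMax_le_orliczMax hn hα hαn hp hq hΦ hu hσ hσ0 hA hf hg).trans ?_
  rw [mul_assoc _ (orliczMaxNorm _ _ _ _ _)]
  gcongr

/-- The truncation of `f` to height and radius `m`. -/
def truncate {n : ℕ} (f : Rn n → ℝ≥0∞) (m : ℕ) : Rn n → ℝ≥0∞ :=
  (Metric.closedBall (0 : Rn n) m).indicator fun x => min (f x) m

lemma truncate_le {n : ℕ} (f : Rn n → ℝ≥0∞) (m : ℕ) (x : Rn n) : truncate f m x ≤ f x := by
  classical
  rw [truncate, indicator_apply]
  split_ifs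
  · exact min_le_left _ _
  · exact zero_le

lemma truncate_ne_top {n : ℕ} (f : Rn n → ℝ≥0∞) (m : ℕ) (x : Rn n) : truncate f m x ≠ ∞ := by
  classical
  rw [truncate, indicator_apply]
  split_ifs
  · exact ne_top_of_le_ne_top (ENNReal.natCast_ne_top m) (min_le_right _ _)
  · exact ENNReal.zero_ne_top

lemma truncate_mono {n : ℕ} (f : Rn n → ℝ≥0∞) : Monotone (truncate f) := by
  intro m l hml x
  have hc : (m : ℝ) ≤ l := by exact_mod_cast hml
  have hc' : (m : ℝ≥0∞) ≤ l := by exact_mod_cast hml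
  classical
  rw [truncate, indicator_apply]
  split_ifs with h
  · rw [truncate, indicator_of_mem (Metric.closedBall_subset_closedBall hc h)]
    exact min_le_min_left _ hc'
  · exact zero_le

lemma iSup_truncate {n : ℕ} (f : Rn n → ℝ≥0∞) (x : Rn n) : ⨆ m, truncate f m x = f x := by
  refine le_antisymm (iSup_le fun m => truncate_le f m x) ?_
  refine le_of_forall_lt_imp_le_of_dense fun t ht => ?_
  obtain ⟨N, hN⟩ := ENNReal.exists_nat_gt (ne_top_of_lt ht)
  obtain ⟨K, hK⟩ := exists_nat_ge ‖x‖
  refine le_trans ?_ (le_iSup _ (max N K))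
  have hx : x ∈ Metric.closedBall (0 : Rn n) (max N K : ℕ) := by
    rw [mem_closedBall_zero_iff]
    exact hK.trans (by exact_mod_cast le_max_right N K)
  rw [truncate, indicator_of_mem hx]
  refine le_min ht.le (hN.le.trans ?_)
  exact_mod_cast le_max_left N K

lemma measurable_truncate {n : ℕ} {f : Rn n → ℝ≥0∞} (hf : Measurable f) (m : ℕ) :
    Measurable (truncate f m) :=
  (hf.min measurable_const).indicator Metric.isClosed_closedBall.measurableSet

lemma lintegral_mulW_truncate_ne_top {n : ℕ} (f : Rn n → ℝ≥0∞) {σ : Rn n → ℝ}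
    (hσ : LocallyIntegrable σ volume) (m : ℕ) : ∫⁻ x, mulW (truncate f m) σ x ≠ ∞ := by
  set B := Metric.closedBall (0 : Rn n) m
  have hB : ∫⁻ x in B, ENNReal.ofReal (σ x) < ∞ :=
    (hσ.integrableOn_isCompact (isCompact_closedBall 0 _)).lintegral_lt_top
  refine ne_top_of_le_ne_top (ENNReal.mul_ne_top (ENNReal.natCast_ne_top m) hB.ne) ?_
  rw [← lintegral_const_mul' _ _ (ENNReal.natCast_ne_top m),
    ← lintegral_indicator Metric.isClosed_closedBall.measurableSet]
  refine lintegral_mono fun x => ?_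
  classical
  simp only [mulW, truncate, indicator_apply]
  split_ifs
  · gcongr
    exact min_le_right _ _
  · simp

lemma LpW_fracMax_le_of_truncate {n : ℕ} (hn : 0 < n) {α q : ℝ} (hq : 0 < q)
    {u σ : Rn n → ℝ} (hu : Measurable u) (hσ : Measurable σ) {f : Rn n → ℝ≥0∞}
    (hf : Measurable f) {X : ℝ≥0∞}
    (h : ∀ m, LpW (fracMax α (mulW (truncate f m) σ)) q u ≤ X) :
    LpW (fracMax α (mulW f σ)) q u ≤ X := by
  have hmono : ∀ x, Monotone fun m => fracMax α (mulW (truncate f m) σ) x := by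
    intro x m l hml
    refine iSup₂_mono fun Q _ => ?_
    gcongr with y
    exact mul_le_mul_left (truncate_mono f hml y) _
  have hsup : ∀ x, fracMax α (mulW f σ) x ≤ ⨆ m, fracMax α (mulW (truncate f m) σ) x := by
    intro x
    refine iSup₂_le fun Q hQ => ?_
    have : ∀ y, mulW f σ y = ⨆ m, mulW (truncate f m) σ y := fun y => by
      simp only [mulW]
      rw [← ENNReal.iSup_mul, iSup_truncate]
    simp_rw [this]
    have hm : ∀ m, Measurable (mulW (truncate f m) σ) := fun m =>
      (measurable_truncate hf m).mul hσ.ennreal_ofReal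
    have hmon : Monotone fun m => mulW (truncate f m) σ := fun m l hml y =>
      mul_le_mul_left (truncate_mono f hml y) _
    rw [lintegral_iSup hm hmon, ENNReal.mul_iSup]
    refine iSup_mono fun m => ?_
    exact le_iSup₂ (f := fun (Q : Cube n) (_ : x ∈ Q.set) =>
      ENNReal.ofReal (Q.vol ^ (α / n - 1)) * ∫⁻ y in Q.set, mulW (truncate f m) σ y) Q hQ
  simp only [LpW, one_div, ENNReal.rpow_inv_le_iff hq] at h ⊢
  calc ∫⁻ x, fracMax α (mulW f σ) x ^ q * ENNReal.ofReal (u x)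
      ≤ ∫⁻ x, ⨆ m, fracMax α (mulW (truncate f m) σ) x ^ q * ENNReal.ofReal (u x) := by
        refine lintegral_mono fun x => ?_
        rw [← ENNReal.iSup_mul]
        gcongr
        refine (ENNReal.rpow_le_rpow (hsup x) hq.le).trans_eq ?_
        exact (ENNReal.orderIsoRpow q hq).map_iSup _
    _ = ⨆ m, ∫⁻ x, fracMax α (mulW (truncate f m) σ) x ^ q * ENNReal.ofReal (u x) := by
        refine lintegral_iSup (fun m => ((measurable_fracMax hn _ _).pow_const _).mul
          hu.ennreal_ofReal) fun m l hml x => ?_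
        exact mul_le_mul_left (ENNReal.rpow_le_rpow (hmono x hml) hq.le) _
    _ ≤ _ := iSup_le h

/-- sharp bump bound for the fractional maximal operator:
with `β = n(1/p - 1/q)`, if `Φ̄ ∈ B^β_p` and `[u,σ]_{A^α_{p,q,Φ}} < ∞`, then
`‖M_α(·σ)‖_{L^p(σ)→L^q(u)} ≤ C [u,σ]_{A^α_{p,q,Φ}} ‖M_{β,Φ̄}‖_{L^p→L^q}`. -/
theorem stmt11 (n : ℕ) (hn : 0 < n) (α p q : ℝ) (hα : 0 ≤ α) (hαn : α < n)
    (hp : 1 < p) (hpq : p ≤ q) :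
    ∃ C : ℝ≥0∞, 0 < C ∧ C < ∞ ∧
      ∀ (Φ : ℝ → ℝ) (u σ : Rn n → ℝ), IsYoung Φ →
        BCond (assocFn Φ) p q → IsWeight u → IsWeight σ →
        bumpA α p q Φ u σ < ∞ →
        opNormStrong (fracMax α) p q σ u ≤
          C * bumpA α p q Φ u σ *
            orliczMaxNorm n (n * (1 / p - 1 / q)) (assocFn Φ) p q := by
  have hq : 0 < q := by linarith
  have hp0 : 0 < p := by linarith
  refine ⟨bumpConst n q, ?_, ?_, ?_⟩
  · unfold bumpConst
    have : (0 : ℝ≥0∞) < (3 ^ n * 2) ^ (1 / q) := ENNReal.rpow_pos (by positivity) (by finiteness)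
    positivity
  · unfold bumpConst
    have : ((3 : ℝ≥0∞) ^ n * 2) ^ (1 / q) ≠ ∞ :=
      ENNReal.rpow_ne_top_of_nonneg (by positivity) (by finiteness)
    finiteness
  intro Φ u σ hΦ _ hu hσ hA
  refine iSup₂_le fun f hf => ?_
  rcases eq_or_ne (LpW f p σ) ∞ with hfp | hfp
  · rw [hfp, ENNReal.div_top]
    exact zero_le
  refine ENNReal.div_le_of_le_mul ?_
  refine LpW_fracMax_le_of_truncate hn hq hu.1 hσ.1 hf fun m => ?_
  have hle : LpW (truncate f m) p σ ≤ LpW f p σ := by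
    unfold LpW
    gcongr with x
    exact truncate_le f m x
  refine (LpW_fracMax_le_of_integrable hn hα hαn hp hq hΦ hu.1 hσ.1 hσ.2.1 hA
    (measurable_truncate hf m) (truncate_ne_top f m)
    (lintegral_mulW_truncate_ne_top f hσ.2.2 m) (ne_top_of_le_ne_top hfp hle)).trans ?_
  gcongr
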